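/- arXiv:1208.6267 — 2 statements merged into one kernel-verified Lean document; each statement's English description precedes it below -/
import Mathlib

section
/- Let R be a noetherian H-UFD. Then: (a) every normal H-eigenvector in R is either a unit or a product of prime H-eigenvectors; (b) a nonunit normal H-eigenvector u in R is a prime element if and only if it is irreducible (whenever u = a·b, either a or b is a unit); (c) if u ∈ R is a nonzero normal H-eigenvector and a, b ∈ R are such that u divides a·b or u divides b·a, and no prime H-eigenvector of R divides both u and a, then u divides b. -/
/-- `u` is a normal element of `R`: `uR = Ru`. -/
def IsNormalElem {R : Type*} [Ring R] (u : R) : Prop :=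
  {y : R | ∃ t : R, y = u * t} = {y : R | ∃ t : R, y = t * u}

/-- For a normal element `u`, `u ∣ a` means `a ∈ Ru`. -/
def NDvd {R : Type*} [Ring R] (u a : R) : Prop := ∃ t : R, a = t * u

/-- A prime element of a domain `R`: a nonzero normal element `p` such that `Rp`
is a completely prime ideal of `R`; in particular `p` is not a unit
(`1 ∉ Rp`). -/
def IsPrimeElem {R : Type*} [Ring R] (p : R) : Prop :=
  p ≠ 0 ∧ IsNormalElem p ∧ ¬ NDvd p 1 ∧
    ∀ a b : R, NDvd p (a * b) → NDvd p a ∨ NDvd p b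

/-- `S` is a two-sided ideal of `R`, as a set. -/
def IsIdealSet {R : Type*} [Ring R] (S : Set R) : Prop :=
  (0 : R) ∈ S ∧ (∀ a ∈ S, ∀ b ∈ S, a + b ∈ S) ∧
    ∀ r : R, ∀ a ∈ S, r * a ∈ S ∧ a * r ∈ S

/-- `S` is a prime two-sided ideal of `R` (elementwise characterization:
`aRb ⊆ S` implies `a ∈ S` or `b ∈ S`, and `S` is proper). -/
def IsPrimeIdealSet {R : Type*} [Ring R] (S : Set R) : Prop :=
  IsIdealSet S ∧ (1 : R) ∉ S ∧
    ∀ a b : R, (∀ t : R, a * t * b ∈ S) → a ∈ S ∨ b ∈ S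

/-- Noncommutative unique factorization domain condition: every nonzero prime
ideal contains a prime element. -/
def IsNCUFD (R : Type*) [Ring R] : Prop :=
  ∀ S : Set R, IsPrimeIdealSet S → S ≠ {0} → ∃ p ∈ S, IsPrimeElem p

section HDefs

variable {K : Type*} [Field K] {R : Type*} [Ring R] [Algebra K R]
variable {H : Type*} [Group H]

/-- `u` is an `H`-eigenvector for the action `φ` of `H` on `R` by `K`-algebra
automorphisms: `u ≠ 0` and each `φ h` rescales `u` by a nonzero scalar. -/
def IsHEigen (φ : H →* (R ≃ₐ[K] R)) (u : R) : Prop :=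
  u ≠ 0 ∧ ∀ h : H, ∃ χ : Kˣ, φ h u = (χ : K) • u

/-- `S` is stable under the action `φ` of `H`. -/
def HStable (φ : H →* (R ≃ₐ[K] R)) (S : Set R) : Prop :=
  ∀ h : H, ∀ a ∈ S, φ h a ∈ S

/-- An `H`-prime ideal of `R`: a proper `H`-stable two-sided ideal `P` such
that `I·J ⊆ P` implies `I ⊆ P` or `J ⊆ P` for all `H`-stable two-sided ideals
`I`, `J`. -/
def IsHPrimeIdeal (φ : H →* (R ≃ₐ[K] R)) (S : Set R) : Prop :=
  IsIdealSet S ∧ HStable φ S ∧ (1 : R) ∉ S ∧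
    ∀ I J : Set R, IsIdealSet I → HStable φ I → IsIdealSet J → HStable φ J →
      (∀ a ∈ I, ∀ b ∈ J, a * b ∈ S) → I ⊆ S ∨ J ⊆ S

/-- `R` is an `H`-UFD: every nonzero `H`-prime ideal contains a prime element
which is an `H`-eigenvector. -/
def IsHUFD (φ : H →* (R ≃ₐ[K] R)) : Prop :=
  ∀ S : Set R, IsHPrimeIdeal φ S → S ≠ {0} →
    ∃ p ∈ S, IsPrimeElem p ∧ IsHEigen φ p

/-- `u` is `H`-normal: for some `h ∈ H`, `u · a = (h · a) · u` for all `a`. -/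
def IsHNormal (φ : H →* (R ≃ₐ[K] R)) (u : R) : Prop :=
  ∃ h : H, ∀ a : R, u * a = φ h a * u

/-- An `H`-prime element: a prime element which is both `H`-normal and an
`H`-eigenvector. -/
def IsHPrimeElem (φ : H →* (R ≃ₐ[K] R)) (p : R) : Prop :=
  IsPrimeElem p ∧ IsHNormal φ p ∧ IsHEigen φ p

/-- `R` is a strong `H`-UFD: every nonzero `H`-prime ideal contains an
`H`-prime element. -/
def IsStrongHUFD (φ : H →* (R ≃ₐ[K] R)) : Prop :=
  ∀ S : Set R, IsHPrimeIdeal φ S → S ≠ {0} → ∃ p ∈ S, IsHPrimeElem φ p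

end HDefs

section NormalElements

variable {R : Type*} [Ring R]

theorem isNormalElem_iff {u : R} :
    IsNormalElem u ↔ (∀ t, ∃ s, u * t = s * u) ∧ ∀ t, ∃ s, t * u = u * s := by
  constructor
  · intro h
    refine ⟨fun t => ?_, fun t => ?_⟩
    · exact (Set.ext_iff.1 h (u * t)).1 ⟨t, rfl⟩
    · exact (Set.ext_iff.1 h (t * u)).2 ⟨t, rfl⟩
  · rintro ⟨h₁, h₂⟩
    ext y
    constructor
    · rintro ⟨t, rfl⟩
      exact h₁ t
    · rintro ⟨t, rfl⟩
      exact h₂ t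

theorem IsNormalElem.exists_mul_eq {u : R} (hu : IsNormalElem u) (t : R) :
    ∃ s, u * t = s * u :=
  (isNormalElem_iff.1 hu).1 t

theorem IsNormalElem.exists_eq_mul {u : R} (hu : IsNormalElem u) (t : R) :
    ∃ s, t * u = u * s :=
  (isNormalElem_iff.1 hu).2 t

theorem IsNormalElem.of_mul_left [IsDomain R] {p v : R} (hp0 : p ≠ 0) (hp : IsNormalElem p)
    (hpv : IsNormalElem (p * v)) : IsNormalElem v := by
  refine isNormalElem_iff.2 ⟨fun t => ?_, fun t => ?_⟩
  · obtain ⟨s, hs⟩ := hpv.exists_mul_eq t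
    obtain ⟨r, hr⟩ := hp.exists_eq_mul s
    refine ⟨r, mul_left_cancel₀ hp0 ?_⟩
    rw [← mul_assoc, hs, ← mul_assoc, hr, mul_assoc]
  · obtain ⟨s, hs⟩ := hp.exists_mul_eq t
    obtain ⟨r, hr⟩ := hpv.exists_eq_mul s
    refine ⟨r, mul_left_cancel₀ hp0 ?_⟩
    rw [← mul_assoc, hs, mul_assoc, hr, mul_assoc]

theorem IsPrimeElem.mul_isUnit [IsDomain R] {p v : R} (hp : IsPrimeElem p) (hv : IsUnit v) :
    IsPrimeElem (p * v) := by
  obtain ⟨hp0, hpn, hp1, hpp⟩ := hp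
  obtain ⟨w, rfl⟩ := hv
  have key : ∀ a, NDvd (p * (w : R)) a ↔ NDvd p a := by
    intro a
    constructor
    · rintro ⟨t, rfl⟩
      obtain ⟨s, hs⟩ := hpn.exists_eq_mul t
      obtain ⟨r, hr⟩ := hpn.exists_mul_eq (s * w)
      exact ⟨r, by rw [← mul_assoc, hs, mul_assoc, hr]⟩
    · rintro ⟨t, rfl⟩
      obtain ⟨s, hs⟩ := hpn.exists_eq_mul t
      obtain ⟨r, hr⟩ := hpn.exists_mul_eq (s * (w⁻¹ : Rˣ))
      exact ⟨r, by rw [← mul_assoc, ← hr, mul_assoc, mul_assoc, Units.inv_mul, mul_one, hs]⟩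
  refine ⟨mul_ne_zero hp0 w.ne_zero, isNormalElem_iff.2 ⟨fun t => ?_, fun t => ?_⟩, ?_, ?_⟩
  · obtain ⟨r, hr⟩ := hpn.exists_mul_eq (w * t)
    exact (key _).2 ⟨r, by rw [mul_assoc, hr]⟩
  · obtain ⟨s, hs⟩ := hpn.exists_eq_mul t
    exact ⟨(w⁻¹ : Rˣ) * (s * w), by
      rw [← mul_assoc, hs, mul_assoc p (w : R), Units.mul_inv_cancel_left, mul_assoc]⟩
  · rwa [key]
  · simpa only [key] using hpp

theorem IsPrimeElem.not_isUnit {p : R} (hp : IsPrimeElem p) : ¬ IsUnit p := by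
  rintro ⟨w, rfl⟩
  exact hp.2.2.1 ⟨(w⁻¹ : Rˣ), by simp⟩

theorem isUnit_of_mul_eq_one_of_isDomain [IsDomain R] {a b : R} (h : a * b = 1) :
    IsUnit a ∧ IsUnit b := by
  have h' : b * a = 1 := mul_eq_one_symm h
  exact ⟨⟨⟨a, b, h, h'⟩, rfl⟩, ⟨⟨b, a, h', h⟩, rfl⟩⟩

theorem IsPrimeElem.isUnit_or_isUnit [IsDomain R] {a b : R} (h : IsPrimeElem (a * b)) :
    IsUnit a ∨ IsUnit b := by
  obtain ⟨h0, hn, -, hp⟩ := h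
  rcases hp a b ⟨1, (one_mul _).symm⟩ with ⟨t, ht⟩ | ⟨t, ht⟩
  · obtain ⟨s, hs⟩ := hn.exists_eq_mul t
    refine Or.inr (isUnit_of_mul_eq_one_of_isDomain (a := s) (mul_left_cancel₀ h0 ?_)).2
    rw [← mul_assoc, ← hs, ← ht, mul_one]
  · refine Or.inl (isUnit_of_mul_eq_one_of_isDomain (b := t) (mul_right_cancel₀ h0 ?_)).1
    rw [mul_assoc, ← ht, one_mul]

end NormalElements

section Eigenvectors

variable {K : Type*} [Field K] {R : Type*} [Ring R] [Algebra K R]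
variable {H : Type*} [Group H] {φ : H →* (R ≃ₐ[K] R)}

theorem IsHEigen.of_mul_left [IsDomain R] {p v : R} (hp : IsHEigen φ p)
    (hpv : IsHEigen φ (p * v)) : IsHEigen φ v := by
  refine ⟨right_ne_zero_of_mul hpv.1, fun h => ?_⟩
  obtain ⟨χ, hχ⟩ := hp.2 h
  obtain ⟨ψ, hψ⟩ := hpv.2 h
  refine ⟨χ⁻¹ * ψ, mul_left_cancel₀ hp.1 ?_⟩
  rw [map_mul, hχ, smul_mul_assoc] at hψ
  rw [mul_smul_comm, Units.val_mul, mul_smul, ← hψ, smul_smul, Units.inv_mul, one_smul]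

/-- `s` is a (possibly empty) product of prime `H`-eigenvectors. -/
def IsHPrimeProd (φ : H →* (R ≃ₐ[K] R)) (s : R) : Prop :=
  ∃ l : List R, (∀ p ∈ l, IsPrimeElem p ∧ IsHEigen φ p) ∧ s = l.prod

theorem IsHPrimeProd.mul {s t : R} (hs : IsHPrimeProd φ s) (ht : IsHPrimeProd φ t) :
    IsHPrimeProd φ (s * t) := by
  obtain ⟨l, hl, rfl⟩ := hs
  obtain ⟨m, hm, rfl⟩ := ht
  refine ⟨l ++ m, fun p hp => ?_, List.prod_append.symm⟩
  rcases List.mem_append.1 hp with h | h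
  exacts [hl p h, hm p h]

theorem IsHPrimeProd.one : IsHPrimeProd φ (1 : R) := ⟨[], by simp, by simp⟩

theorem isUnit_or_exists_prod_of_mul_eq_prod [IsDomain R] (l : List R)
    (hl : ∀ p ∈ l, IsPrimeElem p ∧ IsHEigen φ p) {r u : R} (hu : IsNormalElem u)
    (hue : IsHEigen φ u) (h : l.prod = r * u) :
    IsUnit u ∨ ∃ m : List R, m ≠ [] ∧ (∀ p ∈ m, IsPrimeElem p ∧ IsHEigen φ p) ∧ u = m.prod := by
  induction l generalizing r u with
  | nil => exact Or.inl (isUnit_of_mul_eq_one_of_isDomain (h.symm.trans List.prod_nil)).2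
  | cons p l ih =>
    obtain ⟨hp, hpe⟩ := hl p List.mem_cons_self
    have hl' : ∀ q ∈ l, IsPrimeElem q ∧ IsHEigen φ q :=
      fun q hq => hl q (List.mem_cons_of_mem _ hq)
    rw [List.prod_cons] at h
    rcases hp.2.2.2 r u (h ▸ hp.2.1.exists_mul_eq l.prod) with ⟨t, rfl⟩ | ⟨t, ht⟩
    · obtain ⟨s, hs⟩ := hp.2.1.exists_eq_mul t
      refine ih hl' hu hue (r := s) (mul_left_cancel₀ hp.1 ?_)
      rw [h, hs, mul_assoc]
    · obtain ⟨v, hv⟩ := hp.2.1.exists_eq_mul t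
      obtain rfl : u = p * v := ht.trans hv
      have hve : IsHEigen φ v := hpe.of_mul_left hue
      obtain ⟨s, hs⟩ := hp.2.1.exists_eq_mul r
      have hls : l.prod = s * v :=
        mul_left_cancel₀ hp.1 (by rw [h, ← mul_assoc, hs, mul_assoc])
      rcases ih hl' (.of_mul_left hp.1 hp.2.1 hu) hve hls with hv | ⟨m, -, hm, rfl⟩
      · exact Or.inr ⟨[p * v], by simp, by simpa using ⟨hp.mul_isUnit hv, hue⟩, by simp⟩
      · exact Or.inr ⟨p :: m, by simp, List.forall_mem_cons.2 ⟨⟨hp, hpe⟩, hm⟩, by simp⟩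

theorem exists_isHPrimeIdeal_disjoint [IsNoetherianRing R] {I : Ideal R}
    (hI : IsIdealSet (I : Set R)) (hIH : HStable φ (I : Set R)) {S : Set R}
    (h1 : 1 ∈ S) (hS : ∀ s ∈ S, ∀ t ∈ S, s * t ∈ S) (hIS : ∀ s ∈ S, s ∉ I) :
    ∃ P : Ideal R, I ≤ P ∧ IsHPrimeIdeal φ (P : Set R) ∧ ∀ s ∈ S, s ∉ P := by
  obtain ⟨P, ⟨hIP, hP, hPH, hPS⟩, hmax⟩ := set_has_maximal_iff_noetherian.2 ‹IsNoetherianRing R›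
    {P : Ideal R | I ≤ P ∧ IsIdealSet (P : Set R) ∧ HStable φ (P : Set R) ∧ ∀ s ∈ S, s ∉ P}
    ⟨I, le_rfl, hI, hIH, hIS⟩
  have meets : ∀ J : Set R, IsIdealSet J → HStable φ J → ¬ J ⊆ P →
      ∃ x ∈ P, ∃ y ∈ J, x + y ∈ S := by
    intro J hJ hJH hJP
    let J' : Ideal R :=
      { carrier := J
        zero_mem' := hJ.1
        add_mem' := fun ha hb => hJ.2.1 _ ha _ hb
        smul_mem' := fun r a ha => (hJ.2.2 r a ha).1 }
    by_contra! hcon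
    refine hmax (P ⊔ J') ⟨hIP.trans le_sup_left, ⟨zero_mem _, fun a ha b hb => add_mem ha hb,
      fun r a ha => ⟨Ideal.mul_mem_left _ r ha, ?_⟩⟩, fun h a ha => ?_, fun s hs hsm => ?_⟩ ?_
    · obtain ⟨x, hx, y, hy, rfl⟩ := Submodule.mem_sup.1 ha
      rw [add_mul]
      exact Submodule.add_mem_sup (hP.2.2 r x hx).2 (hJ.2.2 r y hy).2
    · obtain ⟨x, hx, y, hy, rfl⟩ := Submodule.mem_sup.1 ha
      rw [map_add]
      exact Submodule.add_mem_sup (hPH h x hx) (hJH h y hy)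
    · obtain ⟨x, hx, y, hy, rfl⟩ := Submodule.mem_sup.1 hsm
      exact hcon x hx y hy hs
    · exact lt_of_le_of_ne le_sup_left fun h => hJP fun y hy =>
        h ▸ (le_sup_right : J' ≤ P ⊔ J') hy
  refine ⟨P, hIP, ⟨hP, hPH, hPS 1 h1, fun J L hJ hJH hL hLH hJL => ?_⟩, hPS⟩
  by_contra! hcon
  obtain ⟨x, hx, y, hy, hxy⟩ := meets J hJ hJH hcon.1
  obtain ⟨z, hz, w, hw, hzw⟩ := meets L hL hLH hcon.2
  refine hPS _ (hS _ hxy _ hzw) ?_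
  rw [add_mul, mul_add y]
  exact add_mem (hP.2.2 _ x hx).2 (add_mem (hP.2.2 y z hz).1 (hJL y hy w hw))

theorem IsHUFD.isUnit_or_exists_prod [IsDomain R] [IsNoetherianRing R] (hR : IsHUFD φ) {u : R}
    (hu : IsNormalElem u) (hue : IsHEigen φ u) :
    IsUnit u ∨ ∃ l : List R, l ≠ [] ∧
      (∀ p ∈ l, IsPrimeElem p ∧ IsHEigen φ p) ∧ u = l.prod := by
  by_contra hcon
  have hdisj : ∀ s ∈ {s | IsHPrimeProd φ s}, s ∉ Ideal.span {u} := by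
    rintro s ⟨l, hl, rfl⟩ hs
    obtain ⟨r, hr⟩ := Ideal.mem_span_singleton'.1 hs
    exact hcon (isUnit_or_exists_prod_of_mul_eq_prod l hl hu hue hr.symm)
  have hideal : IsIdealSet (Ideal.span {u} : Set R) := by
    refine ⟨zero_mem _, fun a ha b hb => add_mem ha hb,
      fun r a ha => ⟨Ideal.mul_mem_left _ r ha, ?_⟩⟩
    obtain ⟨t, rfl⟩ := Ideal.mem_span_singleton'.1 ha
    obtain ⟨s, hs⟩ := hu.exists_mul_eq r
    exact Ideal.mem_span_singleton'.2 ⟨t * s, by rw [mul_assoc, mul_assoc, hs]⟩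
  have hstable : HStable φ (Ideal.span {u} : Set R) := by
    intro h a ha
    obtain ⟨t, rfl⟩ := Ideal.mem_span_singleton'.1 ha
    obtain ⟨χ, hχ⟩ := hue.2 h
    exact Ideal.mem_span_singleton'.2
      ⟨(χ : K) • φ h t, by rw [map_mul, hχ, smul_mul_assoc, mul_smul_comm]⟩
  obtain ⟨P, hIP, hP, hPS⟩ := exists_isHPrimeIdeal_disjoint hideal hstable
    (S := {s | IsHPrimeProd φ s}) IsHPrimeProd.one (fun s hs t ht => IsHPrimeProd.mul hs ht) hdisj
  have huP : u ∈ P := hIP (Ideal.mem_span_singleton_self u)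
  obtain ⟨p, hpP, hp⟩ := hR P hP fun h => hue.1 (h.subset huP)
  exact hPS p ⟨[p], by simpa using hp, by simp⟩ hpP

theorem ndvd_prod_of_ndvd_mul [IsDomain R] (l : List R)
    (hl : ∀ p ∈ l, IsPrimeElem p ∧ IsHEigen φ p) {a b : R} (h : NDvd l.prod (a * b))
    (hcop : ¬ ∃ p : R, IsPrimeElem p ∧ IsHEigen φ p ∧ NDvd p l.prod ∧ NDvd p a) :
    NDvd l.prod b := by
  induction l using List.reverseRecOn generalizing b with
  | nil => exact ⟨b, by simp⟩
  | append_singleton l p ih =>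
    obtain ⟨hp, hpe⟩ := hl p (by simp)
    simp only [List.prod_append, List.prod_singleton] at h hcop ⊢
    obtain ⟨t, ht⟩ := h
    rcases hp.2.2.2 a b ⟨t * l.prod, by rw [ht, mul_assoc]⟩ with ha | ⟨c, rfl⟩
    · exact absurd ⟨p, hp, hpe, ⟨l.prod, rfl⟩, ha⟩ hcop
    · obtain ⟨s, rfl⟩ := ih (b := c) (fun q hq => hl q (by simp [hq]))
        ⟨t, mul_right_cancel₀ hp.1 (by rw [mul_assoc, ht, mul_assoc])⟩ <| by
          rintro ⟨q, hq, hqe, ⟨s, hs⟩, hqa⟩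
          obtain ⟨r, hr⟩ := hq.2.1.exists_mul_eq p
          exact hcop ⟨q, hq, hqe, ⟨s * r, by rw [hs, mul_assoc, hr, mul_assoc]⟩, hqa⟩
      exact ⟨s, by rw [mul_assoc]⟩

theorem exists_eq_prod_mul_of_mul_eq [IsDomain R] (l : List R)
    (hl : ∀ p ∈ l, IsPrimeElem p ∧ IsHEigen φ p) {a b t : R} (h : b * a = l.prod * t)
    (hcop : ¬ ∃ p : R, IsPrimeElem p ∧ IsHEigen φ p ∧ NDvd p l.prod ∧ NDvd p a) :
    ∃ s, b = l.prod * s := by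
  induction l generalizing b with
  | nil => exact ⟨b, by simp⟩
  | cons p l ih =>
    obtain ⟨hp, hpe⟩ := hl p (by simp)
    rw [List.prod_cons] at h hcop ⊢
    have hpba : NDvd p (b * a) := by
      obtain ⟨r, hr⟩ := hp.2.1.exists_mul_eq (l.prod * t)
      exact ⟨r, by rw [h, mul_assoc, hr]⟩
    rcases hp.2.2.2 b a hpba with ⟨c, hc⟩ | ha
    · obtain ⟨d, hd⟩ := hp.2.1.exists_eq_mul c
      obtain rfl : b = p * d := hc.trans hd
      obtain ⟨s, rfl⟩ := ih (b := d) (fun q hq => hl q (by simp [hq]))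
        (mul_left_cancel₀ hp.1 (by rw [← mul_assoc, h, mul_assoc])) <| by
          rintro ⟨q, hq, hqe, ⟨s, hs⟩, hqa⟩
          exact hcop ⟨q, hq, hqe, ⟨p * s, by rw [hs, mul_assoc]⟩, hqa⟩
      exact ⟨s, by rw [mul_assoc]⟩
    · exact absurd ⟨p, hp, hpe, hp.2.1.exists_mul_eq l.prod, ha⟩ hcop

end Eigenvectors

/-- **Proposition 2.2** of Goodearl–Yakimov: factorization properties in a
noetherian `H`-UFD. -/
theorem stmt4 {K : Type*} [Field K] {R : Type*} [Ring R] [Algebra K R]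
    [IsDomain R] [IsNoetherianRing R] [IsNoetherianRing Rᵐᵒᵖ]
    {H : Type*} [Group H] (φ : H →* (R ≃ₐ[K] R))
    (hR : IsHUFD φ) :
    -- (a)
    (∀ u : R, IsNormalElem u → IsHEigen φ u →
      IsUnit u ∨ ∃ l : List R, l ≠ [] ∧
        (∀ p ∈ l, IsPrimeElem p ∧ IsHEigen φ p) ∧ u = l.prod) ∧
    -- (b)
    (∀ u : R, IsNormalElem u → IsHEigen φ u → ¬ IsUnit u →
      (IsPrimeElem u ↔ ∀ a b : R, u = a * b → IsUnit a ∨ IsUnit b)) ∧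
    -- (c)
    (∀ u a b : R, IsNormalElem u → IsHEigen φ u →
      (NDvd u (a * b) ∨ NDvd u (b * a)) →
      (¬ ∃ p : R, IsPrimeElem p ∧ IsHEigen φ p ∧ NDvd p u ∧ NDvd p a) →
      NDvd u b) := by
  refine ⟨fun u hu hue => hR.isUnit_or_exists_prod hu hue, fun u hu hue hnu => ⟨?_, ?_⟩, ?_⟩
  · rintro hup a b rfl
    exact hup.isUnit_or_isUnit
  · intro hirr
    obtain ⟨l, hne, hl, rfl⟩ := (hR.isUnit_or_exists_prod hu hue).resolve_left hnu
    obtain ⟨p, m, rfl⟩ := List.exists_cons_of_ne_nil hne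
    have hp := (hl p List.mem_cons_self).1
    rw [List.prod_cons] at hirr ⊢
    exact hp.mul_isUnit ((hirr _ _ rfl).resolve_left hp.not_isUnit)
  · intro u a b hu hue hdvd hcop
    rcases hR.isUnit_or_exists_prod hu hue with ⟨w, rfl⟩ | ⟨l, -, hl, rfl⟩
    · exact ⟨b * (w⁻¹ : Rˣ), by simp⟩
    · rcases hdvd with h | ⟨t, ht⟩
      · exact ndvd_prod_of_ndvd_mul l hl h hcop
      · obtain ⟨s, hs⟩ := hu.exists_eq_mul t
        obtain ⟨r, rfl⟩ := exists_eq_prod_mul_of_mul_eq l hl (ht.trans hs) hcop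
        exact hu.exists_mul_eq r
end

section
/- Let R be a noetherian strong H-UFD. Then: (a) every normal H-eigenvector in R can be expressed in the form c·p₁·p₂·⋯·pₙ (n ≥ 0) for some unit H-eigenvector c ∈ R and some H-prime elements pᵢ ∈ R; (b) if u ∈ R is a normal H-eigenvector and a, b ∈ R are such that u divides a·b or u divides b·a, and no H-prime element of R divides both u and a, then u divides b; (c) for any nonzero elements a, b ∈ R one can write a = a′·w and b = b′·w where w is a product of H-prime elements of R (possibly empty) while a′, b′ ∈ R have no common H-prime divisors. -/
theorem IsNormalElem.exists_mul_left {R : Type*} [Ring R] {u : R} (hu : IsNormalElem u) (a : R) :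
    ∃ b, u * a = b * u :=
  hu.subset ⟨a, rfl⟩

theorem IsNormalElem.exists_mul_right {R : Type*} [Ring R] {u : R} (hu : IsNormalElem u) (a : R) :
    ∃ b, a * u = u * b :=
  hu.superset ⟨a, rfl⟩

theorem IsNormalElem.ndvd_mul_right {R : Type*} [Ring R] {p a : R} (hp : IsNormalElem p)
    (h : NDvd p a) (y : R) : NDvd p (a * y) := by
  obtain ⟨t, rfl⟩ := h
  obtain ⟨z, hz⟩ := hp.exists_mul_left y
  exact ⟨t * z, by rw [mul_assoc, hz, mul_assoc]⟩

theorem NDvd.mul_left {R : Type*} [Ring R] {p a : R} (h : NDvd p a) (x : R) :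
    NDvd p (x * a) := by
  obtain ⟨t, rfl⟩ := h
  exact ⟨x * t, by rw [mul_assoc]⟩

theorem IsNormalElem.of_mul_right {R : Type*} [Ring R] [IsDomain R] {v p : R}
    (hp : IsNormalElem p) (hp0 : p ≠ 0) (hu : IsNormalElem (v * p)) : IsNormalElem v := by
  ext y
  constructor
  · rintro ⟨a, rfl⟩
    obtain ⟨b, hb⟩ := hp.exists_mul_right a
    obtain ⟨d, hd⟩ := hu.exists_mul_left b
    refine ⟨d, mul_right_cancel₀ hp0 ?_⟩
    rw [mul_assoc, hb, ← mul_assoc, hd, mul_assoc]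
  · rintro ⟨a, rfl⟩
    obtain ⟨b, hb⟩ := hu.exists_mul_right a
    obtain ⟨d, hd⟩ := hp.exists_mul_left b
    refine ⟨d, mul_right_cancel₀ hp0 ?_⟩
    rw [mul_assoc, hb, mul_assoc, hd, mul_assoc]

/-- Cancelling a prime element on the right strictly enlarges the principal right ideal. -/
theorem span_op_mul_lt {R : Type*} [Ring R] [IsDomain R] {a p : R} (ha : a ≠ 0)
    (hp : IsPrimeElem p) :
    Ideal.span {MulOpposite.op (a * p)} < Ideal.span {MulOpposite.op a} := by
  refine lt_of_le_of_ne ?_ fun h => ?_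
  · rw [Ideal.span_singleton_le_iff_mem, Ideal.mem_span_singleton']
    exact ⟨MulOpposite.op p, rfl⟩
  · have hmem : MulOpposite.op a ∈ Ideal.span {MulOpposite.op (a * p)} :=
      h ▸ Ideal.mem_span_singleton_self _
    obtain ⟨s, hs⟩ := Ideal.mem_span_singleton'.1 hmem
    have hs' : a * p * s.unop = a := congrArg MulOpposite.unop hs
    obtain ⟨b, hb⟩ := hp.2.1.exists_mul_left s.unop
    refine hp.2.2.1 ⟨b, mul_left_cancel₀ ha ?_⟩
    rw [← hb, ← mul_assoc, hs', mul_one]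

/-- If `u` divides a product of prime elements then `u` is a unit or one of them divides `u`. -/
theorem isUnit_or_exists_ndvd {R : Type*} [Ring R] [IsDomain R] {u : R} (l : List R)
    (hl : ∀ p ∈ l, IsPrimeElem p) (h : NDvd u l.prod) :
    IsUnit u ∨ ∃ p ∈ l, NDvd p u := by
  induction l with
  | nil =>
    obtain ⟨t, ht⟩ := h
    rw [List.prod_nil] at ht
    exact Or.inl (IsUnit.of_mul_eq_one_right t ht.symm)
  | cons p l ih =>
    obtain ⟨t, ht⟩ := h
    rw [List.prod_cons] at ht
    have hp := hl p List.mem_cons_self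
    have hdvd : NDvd p (t * u) := ht ▸ hp.2.1.exists_mul_left l.prod
    rcases hp.2.2.2 t u hdvd with ⟨s, rfl⟩ | hpu
    · obtain ⟨s', hs'⟩ := hp.2.1.exists_mul_right s
      have hcancel : l.prod = s' * u := by
        refine mul_left_cancel₀ hp.1 ?_
        rw [ht, hs', mul_assoc]
      rcases ih (fun q hq => hl q (List.mem_cons_of_mem p hq)) ⟨s', hcancel⟩ with
        h | ⟨q, hq, hqu⟩
      · exact Or.inl h
      · exact Or.inr ⟨q, List.mem_cons_of_mem p hq, hqu⟩
    · exact Or.inr ⟨p, List.mem_cons_self, hpu⟩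

section HAction

variable {K : Type*} [Field K] {R : Type*} [Ring R] [Algebra K R]
variable {H : Type*} [Group H]

theorem IsHEigen.of_mul_right [IsDomain R] {φ : H →* (R ≃ₐ[K] R)} {v p : R}
    (hu : IsHEigen φ (v * p)) (hp : IsHEigen φ p) : IsHEigen φ v := by
  refine ⟨left_ne_zero_of_mul hu.1, fun h => ?_⟩
  obtain ⟨χ, hχ⟩ := hu.2 h
  obtain ⟨ψ, hψ⟩ := hp.2 h
  refine ⟨ψ⁻¹ * χ, mul_right_cancel₀ hp.1 ?_⟩
  rw [map_mul, hψ, mul_smul_comm] at hχ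
  rw [Units.val_mul, mul_smul, smul_mul_assoc, smul_mul_assoc, ← hχ, smul_smul,
    Units.inv_mul, one_smul]

theorem IsHEigen.ndvd_of_ndvd_map {φ : H →* (R ≃ₐ[K] R)} {p a : R} (hp : IsHEigen φ p) (h : H)
    (hpa : NDvd p (φ h a)) : NDvd p a := by
  obtain ⟨t, ht⟩ := hpa
  obtain ⟨χ, hχ⟩ := hp.2 h⁻¹
  refine ⟨(χ : K) • φ h⁻¹ t, ?_⟩
  have key := congrArg (φ h⁻¹) ht
  have hinv : φ h⁻¹ (φ h a) = a := by
    rw [← AlgEquiv.mul_apply, ← map_mul, inv_mul_cancel, map_one, AlgEquiv.one_apply]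
  rw [hinv, map_mul, hχ] at key
  rw [key, mul_smul_comm, smul_mul_assoc]

theorem IsIdealSet.span_eq {S : Set R} (hS : IsIdealSet S) : (Ideal.span S : Set R) = S :=
  congrArg SetLike.coe (Submodule.span_eq (p :=
    { carrier := S
      add_mem' := fun ha hb => hS.2.1 _ ha _ hb
      zero_mem' := hS.1
      smul_mem' := fun r _ ha => (hS.2.2 r _ ha).1 }))

theorem IsIdealSet.sup {I J : Ideal R} (hI : IsIdealSet (I : Set R)) (hJ : IsIdealSet (J : Set R)) :
    IsIdealSet ((I ⊔ J : Ideal R) : Set R) := by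
  refine ⟨zero_mem _, fun a ha b hb => add_mem ha hb, fun r a ha => ⟨Ideal.mul_mem_left _ r ha, ?_⟩⟩
  obtain ⟨x, hx, y, hy, rfl⟩ := Submodule.mem_sup.1 ha
  rw [add_mul]
  exact Submodule.add_mem_sup (hI.2.2 r x hx).2 (hJ.2.2 r y hy).2

theorem HStable.sup {φ : H →* (R ≃ₐ[K] R)} {I J : Ideal R} (hI : HStable φ (I : Set R))
    (hJ : HStable φ (J : Set R)) : HStable φ ((I ⊔ J : Ideal R) : Set R) := by
  intro h a ha
  obtain ⟨x, hx, y, hy, rfl⟩ := Submodule.mem_sup.1 ha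
  rw [map_add]
  exact Submodule.add_mem_sup (hI h x hx) (hJ h y hy)

/-- In a left noetherian strong `H`-UFD every nonzero `H`-stable ideal contains a product of
`H`-prime elements. -/
theorem IsStrongHUFD.exists_prod_mem [IsNoetherianRing R] {φ : H →* (R ≃ₐ[K] R)}
    (hR : IsStrongHUFD φ) (I : Ideal R) (hI : IsIdealSet (I : Set R))
    (hs : HStable φ (I : Set R)) (h0 : I ≠ ⊥) :
    ∃ l : List R, (∀ p ∈ l, IsHPrimeElem φ p) ∧ l.prod ∈ I := by
  induction I using WellFoundedGT.induction with
  | ind I ih =>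
    by_cases h1 : (1 : R) ∈ I
    · exact ⟨[], by simp, by simpa using h1⟩
    by_cases hP : IsHPrimeIdeal φ (I : Set R)
    · obtain ⟨p, hpI, hp⟩ := hR I hP fun h => h0 (SetLike.coe_injective (by simpa using h))
      exact ⟨[p], by simpa using hp, by simpa using hpI⟩
    · have hex : ∃ A B : Set R, IsIdealSet A ∧ HStable φ A ∧ IsIdealSet B ∧ HStable φ B ∧
          (∀ a ∈ A, ∀ b ∈ B, a * b ∈ I) ∧ ¬ A ⊆ I ∧ ¬ B ⊆ I := by
        by_contra! hcon
        exact hP ⟨hI, hs, h1, fun A B hA hAs hB hBs hAB =>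
          or_iff_not_imp_left.2 (hcon A B hA hAs hB hBs hAB)⟩
      obtain ⟨A, B, hA, hAs, hB, hBs, hAB, hAI, hBI⟩ := hex
      have larger : ∀ C : Set R, IsIdealSet C → HStable φ C → ¬ C ⊆ I →
          ∃ l : List R, (∀ p ∈ l, IsHPrimeElem φ p) ∧ l.prod ∈ I ⊔ Ideal.span C := by
        intro C hC hCs hCI
        have hlt : I < I ⊔ Ideal.span C := left_lt_sup.2 fun hle =>
          hCI (Ideal.subset_span.trans hle)
        exact ih _ hlt (hI.sup (hC.span_eq.symm ▸ hC)) (hs.sup (hC.span_eq.symm ▸ hCs))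
          (ne_bot_of_gt hlt)
      obtain ⟨l, hl, hlA⟩ := larger A hA hAs hAI
      obtain ⟨m, hm, hmB⟩ := larger B hB hBs hBI
      refine ⟨l ++ m, fun p hp => (List.mem_append.1 hp).elim (hl p) (hm p), ?_⟩
      obtain ⟨x, hx, a, ha, hxa⟩ := Submodule.mem_sup.1 hlA
      obtain ⟨y, hy, b, hb, hyb⟩ := Submodule.mem_sup.1 hmB
      replace ha : a ∈ A := hA.span_eq.subset ha
      replace hb : b ∈ B := hB.span_eq.subset hb
      rw [List.prod_append, ← hxa, ← hyb, add_mul, mul_add a]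
      exact add_mem (hI.2.2 _ x hx).2 (add_mem (hI.2.2 a y hy).1 (hAB a ha b hb))

theorem IsStrongHUFD.isUnit_or_exists_ndvd [IsDomain R] [IsNoetherianRing R]
    {φ : H →* (R ≃ₐ[K] R)} (hR : IsStrongHUFD φ) {u : R} (hu : IsNormalElem u)
    (he : IsHEigen φ u) : IsUnit u ∨ ∃ p, IsHPrimeElem φ p ∧ NDvd p u := by
  have hideal : IsIdealSet (Ideal.span {u} : Set R) := by
    refine ⟨zero_mem _, fun a ha b hb => add_mem ha hb,
      fun r a ha => ⟨Ideal.mul_mem_left _ r ha, ?_⟩⟩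
    obtain ⟨t, rfl⟩ := Ideal.mem_span_singleton'.1 ha
    obtain ⟨s, hs⟩ := hu.ndvd_mul_right ⟨t, rfl⟩ r
    exact Ideal.mem_span_singleton'.2 ⟨s, hs.symm⟩
  have hstable : HStable φ (Ideal.span {u} : Set R) := by
    intro h a ha
    obtain ⟨t, rfl⟩ := Ideal.mem_span_singleton'.1 ha
    obtain ⟨χ, hχ⟩ := he.2 h
    refine Ideal.mem_span_singleton'.2 ⟨(χ : K) • φ h t, ?_⟩
    rw [map_mul, hχ, mul_smul_comm, smul_mul_assoc]
  obtain ⟨l, hl, hmem⟩ := hR.exists_prod_mem _ hideal hstable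
    (by simpa [Ideal.span_singleton_eq_bot] using he.1)
  obtain ⟨t, ht⟩ := Ideal.mem_span_singleton'.1 hmem
  rcases _root_.isUnit_or_exists_ndvd l (fun p hp => (hl p hp).1) ⟨t, ht.symm⟩ with
    h | ⟨p, hp, hpu⟩
  · exact Or.inl h
  · exact Or.inr ⟨p, hl p hp, hpu⟩

theorem IsStrongHUFD.exists_factorization [IsDomain R] [IsNoetherianRing R]
    [IsNoetherianRing Rᵐᵒᵖ] {φ : H →* (R ≃ₐ[K] R)} (hR : IsStrongHUFD φ) (u : R)
    (hu : IsNormalElem u) (he : IsHEigen φ u) :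
    ∃ (c : R) (l : List R), IsUnit c ∧ IsHEigen φ c ∧
      (∀ p ∈ l, IsHPrimeElem φ p) ∧ u = c * l.prod := by
  induction u using (InvImage.wf (fun a : R => Ideal.span {MulOpposite.op a})
    (wellFounded_gt (α := Ideal Rᵐᵒᵖ))).induction with
  | h u ih =>
    rcases hR.isUnit_or_exists_ndvd hu he with h | ⟨p, hp, v, rfl⟩
    · exact ⟨u, [], h, he, by simp, by simp⟩
    · obtain ⟨c, l, hc, hce, hl, rfl⟩ := ih v (span_op_mul_lt (left_ne_zero_of_mul he.1) hp.1)
        (.of_mul_right hp.1.2.1 hp.1.1 hu) (.of_mul_right he hp.2.2)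
      exact ⟨c, l ++ [p], hc, hce,
        by simpa [or_imp, forall_and] using ⟨hl, hp⟩, by simp [mul_assoc]⟩

theorem ndvd_mul_prod_of_mem {p x : R} {l : List R} (hp : IsNormalElem p) (hl : p ∈ l) :
    NDvd p (x * l.prod) := by
  obtain ⟨s, t, rfl⟩ := List.append_of_mem hl
  rw [List.prod_append, List.prod_cons]
  exact (NDvd.mul_left (hp.exists_mul_left t.prod) s.prod).mul_left x

/-- If a product of a unit and `H`-prime elements not dividing `a` divides `a * b`, then it
divides `b`. -/
theorem ndvd_of_ndvd_mul_left [IsDomain R] {φ : H →* (R ≃ₐ[K] R)} {c a : R} (hc : IsUnit c)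
    (l : List R) (hl : ∀ p ∈ l, IsHPrimeElem φ p ∧ ¬ NDvd p a) (b : R)
    (h : NDvd (c * l.prod) (a * b)) : NDvd (c * l.prod) b := by
  induction l using List.reverseRecOn generalizing b with
  | nil =>
    obtain ⟨d, rfl⟩ := hc
    exact ⟨b * ↑d⁻¹, by simp⟩
  | append_singleton l p ih =>
    obtain ⟨hp, hpa⟩ := hl p (by simp)
    obtain ⟨t, ht⟩ := h
    rw [List.prod_append, List.prod_singleton, ← mul_assoc c, ← mul_assoc t] at ht
    obtain ⟨b', rfl⟩ := (hp.1.2.2.2 a b ⟨_, ht⟩).resolve_left hpa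
    rw [← mul_assoc] at ht
    obtain ⟨s, rfl⟩ := ih (fun q hq => hl q (by simp [hq])) b' ⟨t, mul_right_cancel₀ hp.1.1 ht⟩
    exact ⟨s, by simp [mul_assoc]⟩

/-- If a product of a unit and `H`-prime elements not dividing `a` divides `b * a`, then it
divides `b`. -/
theorem ndvd_of_ndvd_mul_right [IsDomain R] {φ : H →* (R ≃ₐ[K] R)} {c a : R} (hc : IsUnit c)
    (l : List R) (hl : ∀ p ∈ l, IsHPrimeElem φ p ∧ ¬ NDvd p a) (b : R)
    (h : NDvd (c * l.prod) (b * a)) : NDvd (c * l.prod) b := by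
  induction l using List.reverseRecOn generalizing a b with
  | nil =>
    obtain ⟨d, rfl⟩ := hc
    exact ⟨b * ↑d⁻¹, by simp⟩
  | append_singleton l p ih =>
    obtain ⟨hp, hpa⟩ := hl p (by simp)
    obtain ⟨t, ht⟩ := h
    rw [List.prod_append, List.prod_singleton, ← mul_assoc c, ← mul_assoc t] at ht
    obtain ⟨b', rfl⟩ := (hp.1.2.2.2 b a ⟨_, ht⟩).resolve_right hpa
    obtain ⟨g, hg⟩ := hp.2.1
    rw [mul_assoc, hg, ← mul_assoc] at ht
    have hl' : ∀ q ∈ l, IsHPrimeElem φ q ∧ ¬ NDvd q (φ g a) := fun q hq =>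
      have ⟨hq', hqa⟩ := hl q (by simp [hq])
      ⟨hq', fun hd => hqa (hq'.2.2.ndvd_of_ndvd_map g hd)⟩
    obtain ⟨s, rfl⟩ := ih hl' b' ⟨t, mul_right_cancel₀ hp.1.1 ht⟩
    exact ⟨s, by simp [mul_assoc]⟩

theorem exists_common_factor [IsDomain R] [IsNoetherianRing Rᵐᵒᵖ] (φ : H →* (R ≃ₐ[K] R))
    (a b : R) (ha : a ≠ 0) :
    ∃ (a' b' : R) (w : List R), (∀ p ∈ w, IsHPrimeElem φ p) ∧
      a = a' * w.prod ∧ b = b' * w.prod ∧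
      ¬ ∃ p : R, IsHPrimeElem φ p ∧ NDvd p a' ∧ NDvd p b' := by
  induction a using (InvImage.wf (fun a : R => Ideal.span {MulOpposite.op a})
    (wellFounded_gt (α := Ideal Rᵐᵒᵖ))).induction generalizing b with
  | h a ih =>
    by_cases h : ∃ p : R, IsHPrimeElem φ p ∧ NDvd p a ∧ NDvd p b
    · obtain ⟨p, hp, ⟨x, rfl⟩, ⟨y, rfl⟩⟩ := h
      have hx := left_ne_zero_of_mul ha
      obtain ⟨a', b', w, hw, rfl, rfl, hcop⟩ := ih x (span_op_mul_lt hx hp.1) y hx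
      exact ⟨a', b', w ++ [p], by simpa [or_imp, forall_and] using ⟨hw, hp⟩,
        by simp [mul_assoc], by simp [mul_assoc], hcop⟩
    · exact ⟨a, b, [], by simp, by simp, by simp, h⟩

end HAction

/-- **Proposition 2.3** of Goodearl–Yakimov: factorization properties in a
noetherian strong `H`-UFD. -/
theorem stmt6 {K : Type*} [Field K] {R : Type*} [Ring R] [Algebra K R]
    [IsDomain R] [IsNoetherianRing R] [IsNoetherianRing Rᵐᵒᵖ]
    {H : Type*} [Group H] (φ : H →* (R ≃ₐ[K] R))
    (hR : IsStrongHUFD φ) :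
    -- (a)
    (∀ u : R, IsNormalElem u → IsHEigen φ u →
      ∃ (c : R) (l : List R), IsUnit c ∧ IsHEigen φ c ∧
        (∀ p ∈ l, IsHPrimeElem φ p) ∧ u = c * l.prod) ∧
    -- (b)
    (∀ u a b : R, IsNormalElem u → IsHEigen φ u →
      (NDvd u (a * b) ∨ NDvd u (b * a)) →
      (¬ ∃ p : R, IsHPrimeElem φ p ∧ NDvd p u ∧ NDvd p a) →
      NDvd u b) ∧
    -- (c)
    (∀ a b : R, a ≠ 0 → b ≠ 0 →
      ∃ (a' b' : R) (w : List R), (∀ p ∈ w, IsHPrimeElem φ p) ∧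
        a = a' * w.prod ∧ b = b' * w.prod ∧
        ¬ ∃ p : R, IsHPrimeElem φ p ∧ NDvd p a' ∧ NDvd p b') := by
  refine ⟨hR.exists_factorization, fun u a b hu he hab hcop => ?_,
    fun a b ha _ => exists_common_factor φ a b ha⟩
  obtain ⟨c, l, hc, -, hl, rfl⟩ := hR.exists_factorization u hu he
  have hl' : ∀ p ∈ l, IsHPrimeElem φ p ∧ ¬ NDvd p a := fun p hp =>
    ⟨hl p hp, fun hpa => hcop ⟨p, hl p hp, ndvd_mul_prod_of_mem (hl p hp).1.2.1 hp, hpa⟩⟩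
  exact hab.elim (ndvd_of_ndvd_mul_left hc l hl' b) (ndvd_of_ndvd_mul_right hc l hl' b)
end
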